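/- arXiv:1308.3862 — 4 statements merged into one kernel-verified Lean document; each statement's English description precedes it below -/
import Mathlib

section
/- For all real numbers λ > 0 and ε > 0, the C¹ solution f of f'' + k_{λ,ε} f = 0 with initial conditions f(0) = 0, f'(0) = 1 satisfies f(t) = A_{λ,ε} sin t + B_{λ,ε} cos t for every t > 2ε, where A_{λ,ε} = (1/(2ελ))·(3(ε² − λ²) sin ε · sin λ · cos²ε + 2ελ cos λ cos ε + sin ε · (ε² + λ² + (λ² − ε²) sin²ε) · sin λ) and B_{λ,ε} = (1/(ελ))·(cos ε · (λ² + (ε² − λ²) cos 2ε) · sin λ − ελ cos λ sin ε). -/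
open Real

/-- The piecewise constant potential `k_{λ,ε}`: equal to `λ²/ε²` on `[ε, 2ε]` and `1` elsewhere. -/
noncomputable def kPot (l e : ℝ) : ℝ → ℝ :=
  fun t => if t ∈ Set.Icc e (2 * e) then l ^ 2 / e ^ 2 else 1

/-- `f : ℝ → ℝ` is a C¹ solution of `f'' + k_{λ,ε} f = 0` with `f 0 = 0`, `f' 0 = 1`. -/
def IsC1Solution (l e : ℝ) (f : ℝ → ℝ) : Prop :=
  ContDiff ℝ 1 f ∧
    (∀ t : ℝ, t ≠ e → t ≠ 2 * e →
      DifferentiableAt ℝ (deriv f) t ∧ deriv (deriv f) t + kPot l e t * f t = 0) ∧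
    f 0 = 0 ∧ deriv f 0 = 1

/-- A function that is continuous on `[a, b]` with zero derivative on `(a, b)` takes the same
value at both endpoints. -/
theorem eq_endpoints_of_hasDerivAt_zero {F : ℝ → ℝ} {a b : ℝ} (hab : a < b) (hF : Continuous F)
    (hF' : ∀ t ∈ Set.Ioo a b, HasDerivAt F 0 t) : F b = F a := by
  obtain ⟨c, -, hc⟩ := exists_hasDerivAt_eq_slope F (fun _ => 0) hab hF.continuousOn hF'
  rw [eq_comm, div_eq_zero_iff] at hc
  rcases hc with h | h <;> linarith

/-- Propagation of Cauchy data of the harmonic oscillator `f'' = -w² f` from `a` to `b`. -/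
theorem harmonic_propagation {f g : ℝ → ℝ} {a b w : ℝ} (hw : w ≠ 0) (hab : a < b)
    (hf : ∀ t, HasDerivAt f (g t) t) (hg : Continuous g)
    (hg' : ∀ t ∈ Set.Ioo a b, HasDerivAt g (-(w ^ 2 * f t)) t) :
    f b = f a * cos (w * (b - a)) + g a / w * sin (w * (b - a)) ∧
      g b = g a * cos (w * (b - a)) - f a * w * sin (w * (b - a)) := by
  have hfc : Continuous f := continuous_iff_continuousAt.2 fun t => (hf t).continuousAt
  have hlin (t : ℝ) : HasDerivAt (fun t => w * (t - a)) w t := by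
    simpa using ((hasDerivAt_id t).sub_const a).const_mul w
  have hP := eq_endpoints_of_hasDerivAt_zero
    (F := fun t => w * f t * cos (w * (t - a)) - g t * sin (w * (t - a))) hab (by fun_prop)
    fun t ht => ((((hf t).const_mul w).mul (hlin t).cos).sub
      ((hg' t ht).mul (hlin t).sin)).congr_deriv (by ring)
  have hQ := eq_endpoints_of_hasDerivAt_zero
    (F := fun t => w * f t * sin (w * (t - a)) + g t * cos (w * (t - a))) hab (by fun_prop)
    fun t ht => ((((hf t).const_mul w).mul (hlin t).sin).add
      ((hg' t ht).mul (hlin t).cos)).congr_deriv (by ring)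
  simp only [sub_self, mul_zero, cos_zero, sin_zero, mul_one, sub_zero, zero_add] at hP hQ
  have h1 := sin_sq_add_cos_sq (w * (b - a))
  constructor
  · field_simp
    linear_combination cos (w * (b - a)) * hP + sin (w * (b - a)) * hQ - w * f b * h1
  · linear_combination cos (w * (b - a)) * hQ - sin (w * (b - a)) * hP - g b * h1

/-- **Explicit form of the solution past `2ε`:**
for `t > 2ε`, `f(t) = A_{λ,ε} sin t + B_{λ,ε} cos t` with the explicit constants
`A_{λ,ε}` and `B_{λ,ε}`. -/
theorem C1Solution_eq_of_gt (l e : ℝ) (hl : 0 < l) (he : 0 < e)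
    (f : ℝ → ℝ) (hf : IsC1Solution l e f) :
    ∀ t : ℝ, 2 * e < t →
      f t = (1 / (2 * e * l)) *
              (3 * (e ^ 2 - l ^ 2) * sin e * sin l * (cos e) ^ 2
                + 2 * e * l * cos l * cos e
                + sin e * (e ^ 2 + l ^ 2 + (l ^ 2 - e ^ 2) * (sin e) ^ 2) * sin l) * sin t
          + (1 / (e * l)) *
              (cos e * (l ^ 2 + (e ^ 2 - l ^ 2) * cos (2 * e)) * sin l
                - e * l * cos l * sin e) * cos t := by
  intro t ht
  obtain ⟨hC, hode, h0, h0'⟩ := hf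
  have hd (x : ℝ) : HasDerivAt f (deriv f x) x :=
    (hC.differentiable one_ne_zero x).hasDerivAt
  have hdc : Continuous (deriv f) := hC.continuous_deriv le_rfl
  have hd2 (x : ℝ) (h1 : x ≠ e) (h2 : x ≠ 2 * e) :
      HasDerivAt (deriv f) (-(kPot l e x * f x)) x := by
    obtain ⟨hx, hx'⟩ := hode x h1 h2
    exact hx.hasDerivAt.congr_deriv (by linarith)
  obtain ⟨fe, ge⟩ := harmonic_propagation one_ne_zero he hd hdc fun x hx => by
    have hk : kPot l e x = 1 := if_neg fun h => by linarith [h.1, hx.2]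
    simpa [hk] using hd2 x hx.2.ne (by linarith [hx.2])
  obtain ⟨f2e, g2e⟩ := harmonic_propagation (w := l / e) (a := e) (b := 2 * e) (by positivity)
    (by linarith) hd hdc fun x hx => by
      have hk : kPot l e x = l ^ 2 / e ^ 2 := if_pos ⟨hx.1.le, hx.2.le⟩
      simpa [hk, div_pow] using hd2 x hx.1.ne' hx.2.ne
  obtain ⟨ft, -⟩ := harmonic_propagation one_ne_zero ht hd hdc fun x hx => by
    have hk : kPot l e x = 1 := if_neg fun h => by linarith [h.2, hx.1]
    simpa [hk] using hd2 x (by linarith [hx.1]) hx.1.ne'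
  have hle : l / e * (2 * e - e) = l := by field_simp; ring
  simp only [h0, h0', sub_zero, one_mul, zero_mul, zero_add, mul_one, div_one] at fe ge
  rw [hle, fe, ge] at f2e g2e
  rw [ft, f2e, g2e, one_mul, cos_sub, sin_sub, sin_two_mul, cos_two_mul]
  have hs := sin_sq e
  have hs3 : sin e ^ 3 = sin e * (1 - cos e ^ 2) := by rw [← hs]; ring
  field_simp
  ring_nf
  simp only [hs3, hs]
  ring
end

section
/- Fix real numbers λ > 0 and t > 0. For each ε with 0 < ε < t/2, let f_ε : ℝ → ℝ be a C¹ solution of f'' + k_{λ,ε} f = 0 with initial conditions f(0) = 0, f'(0) = 1. Then f_ε(t) tends to (cos λ − λ sin λ)·sin t as ε tends to 0 from the right. -/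
open Real Filter

/-- A function continuous on `[a, b]` with zero derivative on `(a, b)` has equal end values. -/
theorem eq_endpoints_of_hasDerivAt_zero_s6 {u : ℝ → ℝ} {a b : ℝ} (hab : a < b)
    (hu : Continuous u) (hd : ∀ x ∈ Set.Ioo a b, HasDerivAt u 0 x) : u b = u a := by
  obtain ⟨c, -, hc⟩ := exists_hasDerivAt_eq_slope u (fun _ => 0) hab hu.continuousOn hd
  have h : b - a ≠ 0 := (sub_pos.2 hab).ne'
  field_simp at hc
  linarith

/-- Transfer formula for the harmonic oscillator `f' = g`, `g' = -w² f` on `(a, b)`. -/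
theorem oscillator_transfer {f g : ℝ → ℝ} {a b w : ℝ} (hab : a < b)
    (hg : Continuous g) (hfg : ∀ x, HasDerivAt f (g x) x)
    (hgf : ∀ x ∈ Set.Ioo a b, HasDerivAt g (-(w ^ 2 * f x)) x) :
    w * f b = w * f a * cos (w * (b - a)) + g a * sin (w * (b - a)) ∧
      g b = g a * cos (w * (b - a)) - w * f a * sin (w * (b - a)) := by
  have hf : Continuous f := continuous_iff_continuousAt.2 fun x => (hfg x).continuousAt
  have hlin (x : ℝ) : HasDerivAt (fun y => w * (b - y)) (-w) x := by
    simpa using ((hasDerivAt_id x).const_sub b).const_mul w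
  constructor
  · have h := eq_endpoints_of_hasDerivAt_zero_s6
      (u := fun x => w * f x * cos (w * (b - x)) + g x * sin (w * (b - x))) hab (by fun_prop)
      fun x hx => ((((hfg x).const_mul w).mul (hlin x).cos).add
        ((hgf x hx).mul (hlin x).sin)).congr_deriv (by ring)
    simpa using h
  · have h := eq_endpoints_of_hasDerivAt_zero_s6
      (u := fun x => g x * cos (w * (b - x)) - w * f x * sin (w * (b - x))) hab (by fun_prop)
      fun x hx => (((hgf x hx).mul (hlin x).cos).sub
        (((hfg x).const_mul w).mul (hlin x).sin)).congr_deriv (by ring)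
    simpa using h

/-- Closed form of a C¹ solution to the right of the bump. -/
theorem IsC1Solution.eval_eq {l e t : ℝ} {f : ℝ → ℝ} (h : IsC1Solution l e f) (hl : 0 < l)
    (he : 0 < e) (het : 2 * e < t) :
    f t = (sin e * cos l + cos e * (e / l) * sin l) * cos (t - 2 * e) +
      (cos e * cos l - l * (sin e / e) * sin l) * sin (t - 2 * e) := by
  obtain ⟨hC, hode, h0, h1⟩ := h
  have hg : Continuous (deriv f) := hC.continuous_deriv le_rfl
  have hfg (x : ℝ) : HasDerivAt f (deriv f x) x :=
    (hC.differentiable one_ne_zero x).hasDerivAt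
  have hgf (x : ℝ) (hx : x ≠ e) (hx' : x ≠ 2 * e) :
      HasDerivAt (deriv f) (-(kPot l e x * f x)) x :=
    (hode x hx hx').1.hasDerivAt.congr_deriv (by linarith [(hode x hx hx').2])
  have hout (x : ℝ) (hx : x < e ∨ 2 * e < x) :
      HasDerivAt (deriv f) (-((1 : ℝ) ^ 2 * f x)) x := by
    have hk : kPot l e x = 1 := if_neg fun hm => by
      rcases hx with hx | hx
      · exact absurd hm.1 (not_le.2 hx)
      · exact absurd hm.2 (not_le.2 hx)
    have := hgf x (by rintro rfl; rcases hx with hx | hx <;> linarith)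
      (by rintro rfl; rcases hx with hx | hx <;> linarith)
    simpa [hk] using this
  have hin (x : ℝ) (hx : x ∈ Set.Ioo e (2 * e)) :
      HasDerivAt (deriv f) (-((l / e) ^ 2 * f x)) x := by
    have hk : kPot l e x = (l / e) ^ 2 := by
      rw [div_pow]
      exact if_pos (Set.Ioo_subset_Icc_self hx)
    simpa [hk] using hgf x hx.1.ne' hx.2.ne
  obtain ⟨f1, g1⟩ := oscillator_transfer he hg hfg fun x hx => hout x (.inl hx.2)
  obtain ⟨f2, g2⟩ := oscillator_transfer (by linarith : e < 2 * e) hg hfg hin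
  obtain ⟨f3, -⟩ := oscillator_transfer het hg hfg fun x hx => hout x (.inr hx.1)
  have hw : l / e * (2 * e - e) = l := by field_simp; ring
  simp only [h0, h1, one_mul, mul_zero, zero_mul, zero_add, sub_zero] at f1 g1
  rw [hw, f1, g1] at f2 g2
  simp only [one_mul] at f3
  have f2' : f (2 * e) = sin e * cos l + cos e * (e / l) * sin l := by
    field_simp at f2 ⊢
    linarith
  rw [f3, f2', g2]
  ring

/-- **Pointwise limit of the solutions as `ε → 0⁺`:** for fixed `λ > 0` and `t > 0`,
if `f ε` is the C¹ solution of `f'' + k_{λ,ε} f = 0`, `f(0)=0`, `f'(0)=1`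
(for every `0 < ε < t/2`), then `f ε t → (cos λ − λ sin λ) · sin t` as `ε → 0⁺`. -/
theorem tendsto_C1Solution_eval (l t : ℝ) (hl : 0 < l) (ht : 0 < t)
    (f : ℝ → ℝ → ℝ) (hf : ∀ e : ℝ, 0 < e → e < t / 2 → IsC1Solution l e (f e)) :
    Tendsto (fun e : ℝ => f e t) (nhdsWithin 0 (Set.Ioi 0))
      (nhds ((cos l - l * sin l) * sin t)) := by
  have hsinc : Tendsto (fun e : ℝ => sin e / e) (nhdsWithin 0 (Set.Ioi 0)) (nhds 1) := by
    have h := (hasDerivAt_sin 0).tendsto_slope_zero_right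
    simpa [div_eq_inv_mul] using h
  have hcont {φ : ℝ → ℝ} (hφ : Continuous φ) :
      Tendsto φ (nhdsWithin 0 (Set.Ioi 0)) (nhds (φ 0)) :=
    hφ.continuousAt.tendsto.mono_left nhdsWithin_le_nhds
  have hlim := (hcont (φ := fun e => (sin e * cos l + cos e * (e / l) * sin l) * cos (t - 2 * e))
    (by fun_prop)).add
    (((hcont (φ := fun e => cos e * cos l) (by fun_prop)).sub
      ((hsinc.const_mul l).mul_const (sin l))).mul
      (hcont (φ := fun e => sin (t - 2 * e)) (by fun_prop)))
  simp only [sin_zero, cos_zero, zero_mul, zero_div, mul_zero, add_zero, zero_add, one_mul,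
    mul_one, sub_zero] at hlim
  refine hlim.congr' ?_
  filter_upwards [Ioo_mem_nhdsGT (half_pos ht)] with e he
  exact ((hf e he.1 he.2).eval_eq hl he.1 (by linarith [he.2])).symm
end

section
/- Fix real numbers λ > 0 and ε > 0, set C = max(1, λ²/ε²), and let f : ℝ → ℝ be a C¹ solution of f'' + k_{λ,ε} f = 0 with initial conditions f(0) = 0, f'(0) = 1. Let (η_n) be a sequence of positive real numbers tending to 0, and for each n let k_n : ℝ → ℝ be a continuous function with 0 ≤ k_n(t) ≤ C for all t ∈ ℝ and k_n(t) = k_{λ,ε}(t) for every t outside [ε − η_n, ε + η_n] ∪ [2ε − η_n, 2ε + η_n]. For each n let g_n : ℝ → ℝ be twice continuously differentiable with g_n''(t) + k_n(t)·g_n(t) = 0 for all t ∈ ℝ, g_n(0) = 0, and g_n'(0) = 1. Then the sequence (g_n) converges to f uniformly on every compact subset of ℝ. -/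
open Real Filter

/-- One-sided Grönwall estimate for `g'' + κ g = 0` against an approximate solution `f`, where the
defect of `f` is measured in the integrated form of the equation. -/
theorem abs_sub_le_gronwallBound_of_nonneg {κ f f' g g' : ℝ → ℝ} {C : NNReal} {T δ : ℝ}
    (hκ : Continuous κ) (hκC : ∀ t, |κ t| ≤ C)
    (hf : ∀ t, HasDerivAt f (f' t) t) (hg : ∀ t, HasDerivAt g (g' t) t)
    (hg' : ∀ t, HasDerivAt g' (-(κ t * g t)) t) (h0 : f 0 = g 0) (h1 : f' 0 = g' 0)
    (hδ : ∀ t ∈ Set.Icc 0 T, |f' t - (f' 0 - ∫ s in (0 : ℝ)..t, κ s * f s)| ≤ δ)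
    {t : ℝ} (ht : t ∈ Set.Icc 0 T) :
    |f t - g t| ≤ gronwallBound 0 (max 1 C : NNReal) δ T := by
  have hfc : Continuous f := continuous_iff_continuousAt.2 fun t => (hf t).continuousAt
  have hδ0 : 0 ≤ δ := (abs_nonneg _).trans (hδ t ht)
  let F : ℝ → ℝ := fun t => f' 0 - ∫ s in (0 : ℝ)..t, κ s * f s
  have hF : ∀ t, HasDerivAt F (-(κ t * f t)) t := fun t =>
    ((hκ.mul hfc).integral_hasStrictDerivAt 0 t).hasDerivAt.const_sub _
  let v : ℝ → ℝ × ℝ → ℝ × ℝ := fun t p => (p.2, -(κ t * p.1))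
  have hv : ∀ t, LipschitzWith (max 1 C) (v t) := by
    refine fun t => LipschitzWith.of_dist_le_mul fun p q => ?_
    have hp1 : |p.1 - q.1| ≤ dist p q := (Real.dist_eq _ _).symm.trans_le (le_max_left _ _)
    have hp2 : |p.2 - q.2| ≤ dist p q := (Real.dist_eq _ _).symm.trans_le (le_max_right _ _)
    have hK1 : (1 : ℝ) ≤ (max 1 C : NNReal) := by exact_mod_cast le_max_left 1 C
    have hKC : (C : ℝ) ≤ (max 1 C : NNReal) := by exact_mod_cast le_max_right 1 C
    rw [Prod.dist_eq]
    refine max_le ?_ ?_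
    · rw [Real.dist_eq]
      exact hp2.trans (le_mul_of_one_le_left dist_nonneg hK1)
    · have : -(κ t * p.1) - -(κ t * q.1) = -(κ t * (p.1 - q.1)) := by ring
      rw [Real.dist_eq, this, abs_neg, abs_mul]
      exact mul_le_mul ((hκC t).trans hKC) hp1 (abs_nonneg _) (NNReal.coe_nonneg _)
  have hfF : ∀ t, HasDerivAt (fun t => (f t, F t)) (f' t, -(κ t * f t)) t := fun t =>
    (hf t).prodMk (hF t)
  have hgg : ∀ t, HasDerivAt (fun t => (g t, g' t)) (g' t, -(κ t * g t)) t := fun t =>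
    (hg t).prodMk (hg' t)
  have key := dist_le_of_approx_trajectories_ODE (a := 0) (b := T) (δ := 0) (εf := δ) (εg := 0) hv
    (fun t _ => (hfF t).continuousAt.continuousWithinAt)
    (fun t _ => (hfF t).hasDerivWithinAt)
    (fun t ht => by
      rw [Prod.dist_eq]
      refine max_le ?_ ?_
      · simpa only [v, F, Real.dist_eq] using hδ t ⟨ht.1, ht.2.le⟩
      · simpa [v] using hδ0)
    (fun t _ => (hgg t).continuousAt.continuousWithinAt)
    (fun t _ => (hgg t).hasDerivWithinAt)
    (fun t _ => by simp [v])
    (by simp [F, h0, h1]) t ht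
  rw [sub_zero, add_zero, Prod.dist_eq] at key
  rw [← Real.dist_eq]
  exact ((le_max_left _ _).trans key).trans
    (gronwallBound_mono le_rfl hδ0 (NNReal.coe_nonneg _) ht.2)

/-- Two-sided version of `abs_sub_le_gronwallBound_of_nonneg`. -/
theorem abs_sub_le_gronwallBound {κ f f' g g' : ℝ → ℝ} {C : NNReal} {T δ : ℝ}
    (hκ : Continuous κ) (hκC : ∀ t, |κ t| ≤ C)
    (hf : ∀ t, HasDerivAt f (f' t) t) (hg : ∀ t, HasDerivAt g (g' t) t)
    (hg' : ∀ t, HasDerivAt g' (-(κ t * g t)) t) (h0 : f 0 = g 0) (h1 : f' 0 = g' 0)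
    (hδ : ∀ t ∈ Set.Icc (-T) T, |f' t - (f' 0 - ∫ s in (0 : ℝ)..t, κ s * f s)| ≤ δ)
    {t : ℝ} (ht : t ∈ Set.Icc (-T) T) :
    |f t - g t| ≤ gronwallBound 0 (max 1 C : NNReal) δ T := by
  rcases le_total 0 t with h | h
  · exact abs_sub_le_gronwallBound_of_nonneg hκ hκC hf hg hg' h0 h1
      (fun s hs => hδ s ⟨by linarith [hs.1, hs.2], hs.2⟩) ⟨h, ht.2⟩
  · have hf_neg : ∀ s, HasDerivAt (fun s => -f (-s)) (f' (-s)) s := fun s => by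
      simpa [Function.comp_def] using ((hf (-s)).scomp s (hasDerivAt_neg s)).fun_neg
    have hg_neg : ∀ s, HasDerivAt (fun s => -g (-s)) (g' (-s)) s := fun s => by
      simpa [Function.comp_def] using ((hg (-s)).scomp s (hasDerivAt_neg s)).fun_neg
    have hg'_neg : ∀ s, HasDerivAt (fun s => g' (-s)) (-(κ (-s) * -g (-s))) s := fun s => by
      simpa [Function.comp_def] using (hg' (-s)).scomp s (hasDerivAt_neg s)
    have key := abs_sub_le_gronwallBound_of_nonneg (κ := fun s => κ (-s)) (T := T) (δ := δ)
      (t := -t) (hκ.comp continuous_neg) (fun s => hκC (-s)) hf_neg hg_neg hg'_neg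
      (by simpa using h0) (by simpa using h1)
      (fun s hs => by
        have hint : ∫ r in (0 : ℝ)..s, κ (-r) * -f (-r) = ∫ r in (0 : ℝ)..-s, κ r * f r := by
          rw [intervalIntegral.integral_symm (-s) 0, ← neg_zero (G := ℝ),
            ← intervalIntegral.integral_comp_neg]
          simp
        rw [hint, neg_zero]
        exact hδ (-s) ⟨by linarith [hs.2], by linarith [hs.1, hs.2]⟩)
      ⟨by linarith, by linarith [ht.1]⟩
    rw [neg_neg] at key
    rwa [show -f t - -g t = -(f t - g t) by ring, abs_neg] at key

theorem measurable_kPot (l e : ℝ) : Measurable (kPot l e) :=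
  Measurable.ite measurableSet_Icc measurable_const measurable_const

theorem kPot_nonneg (l e t : ℝ) : 0 ≤ kPot l e t := by
  unfold kPot
  split_ifs <;> positivity

theorem kPot_le (l e t : ℝ) : kPot l e t ≤ max 1 (l ^ 2 / e ^ 2) := by
  unfold kPot
  split_ifs
  exacts [le_max_right _ _, le_max_left _ _]

theorem intervalIntegrable_kPot_mul (l e : ℝ) {f : ℝ → ℝ} (hf : Continuous f) (a b : ℝ) :
    IntervalIntegrable (fun t => kPot l e t * f t) MeasureTheory.volume a b := by
  refine IntervalIntegrable.mono_fun' (g := fun t => max 1 (l ^ 2 / e ^ 2) * |f t|)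
    ((continuous_const.mul hf.abs).intervalIntegrable a b)
    ((measurable_kPot l e).mul hf.measurable).aestronglyMeasurable (MeasureTheory.ae_of_all _ fun t => ?_)
  beta_reduce
  rw [Real.norm_eq_abs, abs_mul, abs_of_nonneg (kPot_nonneg l e t)]
  exact mul_le_mul_of_nonneg_right (kPot_le l e t) (abs_nonneg _)

/-- The integrated form of the equation satisfied by a C¹ solution. -/
theorem IsC1Solution.deriv_eq {l e : ℝ} {f : ℝ → ℝ} (hf : IsC1Solution l e f) (t : ℝ) :
    deriv f t = deriv f 0 - ∫ s in (0 : ℝ)..t, kPot l e s * f s := by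
  obtain ⟨hf1, hode, -, -⟩ := hf
  have hftc := MeasureTheory.integral_eq_of_hasDerivAt_off_countable (deriv f)
    (fun s => -(kPot l e s * f s)) (a := 0) (b := t) (s := {e, 2 * e})
    (Set.toFinite _).countable (hf1.continuous_deriv le_rfl).continuousOn
    (fun s hs => by
      have hs' : s ≠ e ∧ s ≠ 2 * e := by simpa using hs.2
      obtain ⟨hd, heq⟩ := hode s hs'.1 hs'.2
      rw [← eq_neg_of_add_eq_zero_left heq]
      exact hd.hasDerivAt)
    (intervalIntegrable_kPot_mul l e hf1.continuous 0 t).neg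
  rw [intervalIntegral.integral_neg] at hftc
  linarith

/-- Potentials that agree with `kPot l e` off shrinking neighbourhoods of `e` and `2 * e` converge
to it off these two points. -/
theorem tendsto_kPot {l e : ℝ} {η : ℕ → ℝ} (hη0 : Tendsto η atTop (nhds 0)) {kn : ℕ → ℝ → ℝ}
    (hkeq : ∀ n, ∀ t : ℝ,
      t ∉ Set.Icc (e - η n) (e + η n) ∪ Set.Icc (2 * e - η n) (2 * e + η n) →
        kn n t = kPot l e t)
    {t : ℝ} (h1 : t ≠ e) (h2 : t ≠ 2 * e) :
    Tendsto (fun n => kn n t) atTop (nhds (kPot l e t)) := by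
  refine tendsto_const_nhds.congr' ?_
  filter_upwards [hη0.eventually_lt_const (abs_pos.2 (sub_ne_zero.2 h1)),
    hη0.eventually_lt_const (abs_pos.2 (sub_ne_zero.2 h2))] with n hn1 hn2
  refine (hkeq n t ?_).symm
  rintro (h | h)
  · exact absurd (abs_le.2 ⟨by linarith [h.1], by linarith [h.2]⟩) hn1.not_ge
  · exact absurd (abs_le.2 ⟨by linarith [h.1], by linarith [h.2]⟩) hn2.not_ge

/-- **Stability of the solution under smoothing of the potential:**
if `kn n` are continuous potentials with `0 ≤ kn n ≤ max(1, λ²/ε²)`, agreeing with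
`k_{λ,ε}` outside `[ε−η n, ε+η n] ∪ [2ε−η n, 2ε+η n]` where `η n → 0`, `η n > 0`, and
`g n` are C² solutions of `g'' + (kn n) g = 0`, `g(0)=0`, `g'(0)=1`, then `g n → f`
uniformly on every compact subset of `ℝ`, where `f` is the C¹ solution for `k_{λ,ε}`. -/
theorem tendsto_solutions_of_smoothed_potential (l e : ℝ) (hl : 0 < l) (he : 0 < e)
    (f : ℝ → ℝ) (hf : IsC1Solution l e f)
    (η : ℕ → ℝ) (hη : ∀ n, 0 < η n) (hη0 : Tendsto η atTop (nhds 0))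
    (kn : ℕ → ℝ → ℝ) (hkc : ∀ n, Continuous (kn n))
    (hk0 : ∀ n, ∀ t : ℝ, 0 ≤ kn n t) (hkC : ∀ n, ∀ t : ℝ, kn n t ≤ max 1 (l ^ 2 / e ^ 2))
    (hkeq : ∀ n, ∀ t : ℝ,
      t ∉ Set.Icc (e - η n) (e + η n) ∪ Set.Icc (2 * e - η n) (2 * e + η n) →
        kn n t = kPot l e t)
    (g : ℕ → ℝ → ℝ) (hg : ∀ n, ContDiff ℝ 2 (g n))
    (hgode : ∀ n, ∀ t : ℝ, deriv (deriv (g n)) t + kn n t * g n t = 0)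
    (hg0 : ∀ n, g n 0 = 0) (hg1 : ∀ n, deriv (g n) 0 = 1) :
    ∀ K : Set ℝ, IsCompact K → TendstoUniformlyOn (fun n => g n) f atTop K := by
  intro K hK
  set C : ℝ := max 1 (l ^ 2 / e ^ 2)
  have hC0 : 0 ≤ C := zero_le_one.trans (le_max_left _ _)
  have hfc : Continuous f := hf.1.continuous
  obtain ⟨R, hR⟩ := hK.isBounded.subset_closedBall 0
  set T : ℝ := max R 0
  have hT : 0 ≤ T := le_max_right _ _
  have hKT : K ⊆ Set.Icc (-T) T := fun t ht => by
    have : |t| ≤ R := by simpa using hR ht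
    exact abs_le.1 (this.trans (le_max_left _ _))
  let h : ℕ → ℝ → ℝ := fun n t => kPot l e t * f t - kn n t * f t
  have hh : ∀ n a b, IntervalIntegrable (h n) MeasureTheory.volume a b := fun n a b =>
    (intervalIntegrable_kPot_mul l e hfc a b).sub (((hkc n).mul hfc).intervalIntegrable a b)
  let δ : ℕ → ℝ := fun n => ∫ t in (-T)..T, |h n t|
  have hδ : Tendsto δ atTop (nhds 0) := by
    have key : Tendsto δ atTop (nhds (∫ _ in (-T)..T, (0 : ℝ))) := by
      refine intervalIntegral.tendsto_integral_filter_of_dominated_convergence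
        (fun t => C * |f t|) (Eventually.of_forall fun n => (hh n _ _).def'.1.norm)
        (Eventually.of_forall fun n => MeasureTheory.ae_of_all _ fun t _ => ?_)
        ((continuous_const.mul hfc.abs).intervalIntegrable _ _) ?_
      · simp only [Real.norm_eq_abs, abs_abs, h, ← sub_mul, abs_mul]
        refine mul_le_mul_of_nonneg_right (abs_le.2 ⟨?_, ?_⟩) (abs_nonneg _) <;>
          linarith [kPot_nonneg l e t, kPot_le l e t, hk0 n t, hkC n t]
      · filter_upwards [(Set.toFinite {e, 2 * e}).measure_zero MeasureTheory.volume
          |> MeasureTheory.compl_mem_ae_iff.2] with t ht _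
        have ht' : t ≠ e ∧ t ≠ 2 * e := by simpa using ht
        simpa [h] using ((tendsto_const_nhds (x := kPot l e t * f t)).sub
          ((tendsto_kPot hη0 hkeq ht'.1 ht'.2).mul_const (f t))).abs
    simpa using key
  have hdefect : ∀ n, ∀ t ∈ Set.Icc (-T) T,
      |deriv f t - (deriv f 0 - ∫ s in (0 : ℝ)..t, kn n s * f s)| ≤ δ n := fun n t ht => by
    have : deriv f t - (deriv f 0 - ∫ s in (0 : ℝ)..t, kn n s * f s)
        = -∫ s in (0 : ℝ)..t, h n s := by
      have hsub := intervalIntegral.integral_sub (intervalIntegrable_kPot_mul l e hfc 0 t)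
        (((hkc n).fun_mul hfc).intervalIntegrable 0 t)
      rw [hf.deriv_eq t, hsub]
      ring
    rw [this, abs_neg, ← Real.norm_eq_abs]
    refine intervalIntegral.norm_integral_le_abs_integral_norm.trans ?_
    refine (intervalIntegral.abs_integral_mono_interval (c := -T) (d := T) ?_
      (MeasureTheory.ae_of_all _ fun s => norm_nonneg _) (hh n _ _).norm).trans_eq
      (abs_of_nonneg (intervalIntegral.integral_nonneg (by linarith) fun s _ => abs_nonneg _))
    rw [Set.uIoc_of_le (by linarith : -T ≤ T)]
    exact Set.Ioc_subset_Ioc (le_min (by linarith) ht.1) (max_le hT ht.2)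
  have hbound : ∀ n, ∀ t ∈ Set.Icc (-T) T,
      |f t - g n t| ≤ gronwallBound 0 (max 1 C.toNNReal : NNReal) (δ n) T := fun n t ht =>
    abs_sub_le_gronwallBound (hkc n)
      (fun s => by
        rw [Real.coe_toNNReal _ hC0, abs_of_nonneg (hk0 n s)]
        exact hkC n s)
      (fun s => (hf.1.differentiable one_ne_zero s).hasDerivAt)
      (fun s => ((hg n).differentiable two_ne_zero s).hasDerivAt)
      (fun s => by
        rw [← eq_neg_of_add_eq_zero_left (hgode n s)]
        exact ((hg n).differentiable_deriv_two s).hasDerivAt)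
      (by rw [hf.2.2.1, hg0 n]) (by rw [hf.2.2.2, hg1 n]) (hdefect n) ht
  have hlim : Tendsto (fun n => gronwallBound 0 (max 1 C.toNNReal : NNReal) (δ n) T) atTop
      (nhds 0) := by
    simpa only [gronwallBound_ε0_δ0, Function.comp_def] using
      ((gronwallBound_continuous_ε 0 (max 1 C.toNNReal : NNReal) T).tendsto 0).comp hδ
  refine Metric.tendstoUniformlyOn_iff.2 fun r hr => ?_
  filter_upwards [hlim.eventually_lt_const hr] with n hn t ht
  exact (hbound n t (hKT ht)).trans_lt hn
end

section
/- For every real number ω with 0 < ω < 2π and every real number τ with 0 < τ < π/2, there exist an infinitely differentiable function f : ℝ → ℝ, a real number φ with |φ| < τ, and a real number δ > 0 such that: f(t) = sin t for all t ∈ [0, δ]; f(t) = (1 − ω/(2π))·sin(t + φ) for all t ∈ [τ, π/2]; f(t) > 0 for all t ∈ (0, π/2]; and f''(t) + f(t) ≤ 0 for all t ∈ [0, π/2]. -/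
open Real

/-- A primitive of a smooth function is smooth. -/
theorem contDiff_integral_of_contDiff {g : ℝ → ℝ} (hg : ContDiff ℝ (⊤ : ℕ∞) g) (a : ℝ) :
    ContDiff ℝ (⊤ : ℕ∞) fun t => ∫ s in a..t, g s := by
  have hderiv : ∀ t, HasDerivAt (fun t => ∫ s in a..t, g s) (g t) t := fun t =>
    intervalIntegral.integral_hasDerivAt_right (hg.continuous.intervalIntegrable _ _)
      hg.continuous.aestronglyMeasurable.stronglyMeasurableAtFilter hg.continuous.continuousAt
  refine contDiff_infty_iff_deriv.2 ⟨fun t => (hderiv t).differentiableAt, ?_⟩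
  rwa [show deriv (fun t => ∫ s in a..t, g s) = g from funext fun t => (hderiv t).deriv]

/-- The solution of `f'' + f = -g`, `f 0 = 0`, `f' 0 = 1` given by variation of constants. -/
noncomputable def forcedSine (g : ℝ → ℝ) (t : ℝ) : ℝ :=
  (1 - ∫ s in (0 : ℝ)..t, g s * cos s) * sin t + (∫ s in (0 : ℝ)..t, g s * sin s) * cos t

theorem contDiff_forcedSine {g : ℝ → ℝ} (hg : ContDiff ℝ (⊤ : ℕ∞) g) :
    ContDiff ℝ (⊤ : ℕ∞) (forcedSine g) := by
  have hC := contDiff_integral_of_contDiff (hg.mul contDiff_cos) 0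
  have hS := contDiff_integral_of_contDiff (hg.mul contDiff_sin) 0
  exact ((contDiff_const.sub hC).mul contDiff_sin).add (hS.mul contDiff_cos)

theorem deriv_deriv_forcedSine {g : ℝ → ℝ} (hg : Continuous g) (t : ℝ) :
    deriv (deriv (forcedSine g)) t = -g t - forcedSine g t := by
  have hC : ∀ t, HasDerivAt (fun t => ∫ s in (0 : ℝ)..t, g s * cos s) (g t * cos t) t := fun t =>
    (hg.mul continuous_cos).integral_hasStrictDerivAt 0 t |>.hasDerivAt
  have hS : ∀ t, HasDerivAt (fun t => ∫ s in (0 : ℝ)..t, g s * sin s) (g t * sin t) t := fun t =>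
    (hg.mul continuous_sin).integral_hasStrictDerivAt 0 t |>.hasDerivAt
  have h1 : deriv (forcedSine g) = fun t =>
      (1 - ∫ s in (0 : ℝ)..t, g s * cos s) * cos t
        - (∫ s in (0 : ℝ)..t, g s * sin s) * sin t := by
    funext t
    refine HasDerivAt.deriv ?_
    refine ((((hC t).const_sub 1).mul (hasDerivAt_sin t)).add
      ((hS t).mul (hasDerivAt_cos t))).congr_deriv ?_
    ring
  rw [h1]
  refine HasDerivAt.deriv ?_
  refine ((((hC t).const_sub 1).mul (hasDerivAt_cos t)).sub
    ((hS t).mul (hasDerivAt_sin t))).congr_deriv ?_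
  unfold forcedSine
  linear_combination (-g t) * sin_sq_add_cos_sq t

/-- If `g` vanishes between `a` and `b`, so does the integral of `g * h`. -/
theorem integral_mul_eq_zero_of_eq_zero {g h : ℝ → ℝ} {a b : ℝ}
    (hg : ∀ s ∈ Set.uIcc a b, g s = 0) : ∫ s in a..b, g s * h s = 0 := by
  rw [intervalIntegral.integral_congr (g := fun _ => (0 : ℝ)) fun s hs => by simp [hg s hs]]
  simp

theorem forcedSine_eq_sin {g : ℝ → ℝ} {t : ℝ} (ht : 0 ≤ t)
    (hg : ∀ s ∈ Set.Icc 0 t, g s = 0) : forcedSine g t = sin t := by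
  rw [← Set.uIcc_of_le ht] at hg
  simp [forcedSine, integral_mul_eq_zero_of_eq_zero hg]

theorem forcedSine_eq_of_eq_zero {g : ℝ → ℝ} (hg : Continuous g) {a b : ℝ}
    (h : ∀ s ∈ Set.Icc a b, g s = 0) {t : ℝ} (ht : t ∈ Set.Icc a b) :
    forcedSine g t = (1 - ∫ s in (0 : ℝ)..b, g s * cos s) * sin t
      + (∫ s in (0 : ℝ)..b, g s * sin s) * cos t := by
  have h0 : ∀ s ∈ Set.uIcc t b, g s = 0 := fun s hs => by
    rw [Set.uIcc_of_le ht.2] at hs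
    exact h s ⟨ht.1.trans hs.1, hs.2⟩
  have key : ∀ k : ℝ → ℝ, Continuous k →
      ∫ s in (0 : ℝ)..t, g s * k s = ∫ s in (0 : ℝ)..b, g s * k s := fun k hk => by
    have hgk : Continuous fun s => g s * k s := hg.mul hk
    rw [← intervalIntegral.integral_add_adjacent_intervals (b := t) (c := b)
      (hgk.intervalIntegrable _ _) (hgk.intervalIntegrable _ _),
      integral_mul_eq_zero_of_eq_zero h0, add_zero]
  rw [forcedSine, key _ continuous_cos, key _ continuous_sin]

theorem forcedSine_pos {g : ℝ → ℝ} (hg : Continuous g) (h0 : ∀ s, 0 ≤ g s)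
    (h1 : ∫ s in (0 : ℝ)..(π / 2), g s * cos s < 1) {t : ℝ} (ht : t ∈ Set.Ioc 0 (π / 2)) :
    0 < forcedSine g t := by
  obtain ⟨ht0, ht1⟩ := ht
  have hcos : 0 ≤ ∫ s in t..(π / 2), g s * cos s :=
    intervalIntegral.integral_nonneg ht1 fun s hs =>
      mul_nonneg (h0 s) (cos_nonneg_of_mem_Icc ⟨by linarith [hs.1, pi_pos], hs.2⟩)
  have hsin : 0 ≤ ∫ s in (0 : ℝ)..t, g s * sin s :=
    intervalIntegral.integral_nonneg ht0.le fun s hs =>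
      mul_nonneg (h0 s) (sin_nonneg_of_nonneg_of_le_pi hs.1 (by linarith [hs.2, pi_pos]))
  have hadd := intervalIntegral.integral_add_adjacent_intervals (μ := MeasureTheory.volume)
    ((hg.mul continuous_cos).intervalIntegrable 0 t)
    ((hg.mul continuous_cos).intervalIntegrable t (π / 2))
  simp only [Pi.mul_apply] at hadd
  refine add_pos_of_pos_of_nonneg (mul_pos (by linarith)
    (sin_pos_of_pos_of_lt_pi ht0 (by linarith [pi_pos])))
    (mul_nonneg hsin (cos_nonneg_of_mem_Icc ⟨by linarith [pi_pos], ht1⟩))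

/-- A direction with small slope can be scaled so as to move `(1, 0)` onto the circle of
radius `c < 1`, at a small polar angle. -/
theorem exists_scale_polar {c τ C S : ℝ} (hc0 : 0 < c) (hc1 : c < 1) (hτ0 : 0 < τ)
    (hτ : τ < π / 2) (hC : 0 < C) (hS : 0 ≤ S) (hSC : S < c * sin τ * C) :
    ∃ l φ : ℝ, 0 ≤ l ∧ l * C < 1 ∧ |φ| < τ ∧ 1 - l * C = c * cos φ ∧ l * S = c * sin φ := by
  have hsin1 : sin τ ≤ 1 := sin_le_one τ
  have hend : S / C < c * sin τ := by rwa [div_lt_iff₀ hC]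
  have hend0 : 0 ≤ S / C := by positivity
  have hendc : S / C < c := hend.trans_le (by nlinarith)
  have hcont : ContinuousOn (fun l : ℝ => (1 - l * C) ^ 2 + (l * S) ^ 2) (Set.Icc 0 (1 / C)) := by
    fun_prop
  have hval : (1 - 1 / C * C) ^ 2 + (1 / C * S) ^ 2 = (S / C) ^ 2 := by
    field_simp
    ring
  obtain ⟨l, ⟨hl0, hl1⟩, hl⟩ := intermediate_value_Icc' (by positivity) hcont
    (show c ^ 2 ∈ _ by
      constructor
      · simp only [hval]
        nlinarith
      · simp only [zero_mul]
        nlinarith)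
  simp only at hl
  have hlC : l * C < 1 := by
    refine lt_of_le_of_ne ((le_div_iff₀ hC).1 hl1) fun h => ?_
    rw [eq_div_of_mul_eq hC.ne' h, hval] at hl
    nlinarith
  have hlS : l * S ≤ S / C := by
    rw [le_div_iff₀ hC]
    nlinarith
  have hx0 : 0 ≤ l * S / c := by positivity
  have hx1 : l * S / c < sin τ := by
    rw [div_lt_iff₀ hc0]
    linarith
  have hsφ : sin (arcsin (l * S / c)) = l * S / c :=
    sin_arcsin (by linarith) (by linarith)
  refine ⟨l, arcsin (l * S / c), hl0, hlC, ?_, ?_, ?_⟩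
  · rw [abs_of_nonneg (arcsin_nonneg.2 hx0)]
    exact (arcsin_lt_iff_lt_sin' ⟨by linarith [pi_pos], hτ.le⟩).2 hx1
  · refine (sq_eq_sq₀ (by linarith) (mul_nonneg hc0.le (cos_arcsin_nonneg _))).1 ?_
    have h2 : c * (l * S / c) = l * S := by field_simp
    rw [mul_pow, cos_sq', hsφ]
    linear_combination hl + (c * (l * S / c) + l * S) * h2
  · rw [hsφ]
    field_simp

/-- **Smoothing a conical warped metric:** for `0 < ω < 2π` and `0 < τ < π/2`, there
exist a smooth function `f : ℝ → ℝ`, a phase `φ` with `|φ| < τ` and `δ > 0` such that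
`f = sin` on `[0, δ]`, `f(t) = (1 − ω/(2π)) sin(t + φ)` on `[τ, π/2]`, `f > 0` on
`(0, π/2]`, and `f'' + f ≤ 0` on `[0, π/2]`. -/
theorem exists_smooth_warping_function (ω τ : ℝ)
    (hω0 : 0 < ω) (hω : ω < 2 * π) (hτ0 : 0 < τ) (hτ : τ < π / 2) :
    ∃ (f : ℝ → ℝ) (φ δ : ℝ), ContDiff ℝ (⊤ : ℕ∞) f ∧ |φ| < τ ∧ 0 < δ ∧
      (∀ t ∈ Set.Icc (0 : ℝ) δ, f t = sin t) ∧
      (∀ t ∈ Set.Icc τ (π / 2), f t = (1 - ω / (2 * π)) * sin (t + φ)) ∧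
      (∀ t ∈ Set.Ioc (0 : ℝ) (π / 2), 0 < f t) ∧
      (∀ t ∈ Set.Icc (0 : ℝ) (π / 2), deriv (deriv f) t + f t ≤ 0) := by
  set c := 1 - ω / (2 * π) with hc
  have hc0 : 0 < c := sub_pos.2 ((div_lt_one (by positivity)).2 hω)
  have hc1 : c < 1 := sub_lt_self _ (by positivity)
  have hsτ : 0 < sin τ := sin_pos_of_pos_of_lt_pi hτ0 (by linarith)
  obtain ⟨σ, hσtan, hστ, hσ0⟩ : ∃ σ, tan σ < c * sin τ ∧ σ < τ ∧ 0 < σ := by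
    have htan : ContinuousAt tan 0 := continuousAt_tan.2 (by simp)
    have h1 : ∀ᶠ σ in nhds (0 : ℝ), tan σ < c * sin τ :=
      htan.eventually_lt_const (by simpa using mul_pos hc0 hsτ)
    exact ((h1.and (eventually_lt_nhds hτ0)).filter_mono nhdsWithin_le_nhds |>.and
      (eventually_mem_nhdsWithin (s := Set.Ioi (0 : ℝ)))).exists.imp
        fun σ h => ⟨h.1.1, h.1.2, h.2⟩
  let b : ContDiffBump (σ / 2) := ⟨σ / 8, σ / 4, by positivity, by linarith⟩
  have hb : ContDiff ℝ (⊤ : ℕ∞) b := b.contDiff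
  have hb_left : ∀ s ≤ σ / 4, b s = 0 := fun s hs => b.zero_of_le_dist (by
    rw [dist_eq, abs_sub_comm]
    exact le_trans (show σ / 4 ≤ _ by linarith) (le_abs_self _))
  have hb_right : ∀ s, σ ≤ s → b s = 0 := fun s hs => b.zero_of_le_dist (by
    rw [dist_eq]
    exact le_trans (show σ / 4 ≤ _ by linarith) (le_abs_self _))
  have hcos : ∀ s ∈ Set.Icc 0 (π / 2), 0 ≤ cos s := fun s hs =>
    cos_nonneg_of_mem_Icc ⟨by linarith [hs.1, pi_pos], hs.2⟩
  have hbcos : Continuous fun s => b s * cos s := hb.continuous.mul continuous_cos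
  have hbsin : Continuous fun s => b s * sin s := hb.continuous.mul continuous_sin
  have hC : 0 < ∫ s in (0 : ℝ)..(π / 2), b s * cos s := by
    refine intervalIntegral.integral_pos (by positivity) hbcos.continuousOn
      (fun s hs => mul_nonneg b.nonneg (hcos s ⟨hs.1.le, hs.2⟩))
      ⟨σ / 2, ⟨by positivity, by linarith⟩, mul_pos ?_ ?_⟩
    · exact b.pos_of_mem_ball (Metric.mem_ball_self b.rOut_pos)
    · exact cos_pos_of_mem_Ioo ⟨by linarith, by linarith⟩
  have hS : 0 ≤ ∫ s in (0 : ℝ)..(π / 2), b s * sin s :=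
    intervalIntegral.integral_nonneg (by positivity) fun s hs =>
      mul_nonneg b.nonneg (sin_nonneg_of_nonneg_of_le_pi hs.1 (by linarith [hs.2]))
  have hSC : ∫ s in (0 : ℝ)..(π / 2), b s * sin s
      ≤ tan σ * ∫ s in (0 : ℝ)..(π / 2), b s * cos s := by
    rw [← intervalIntegral.integral_const_mul]
    refine intervalIntegral.integral_mono_on (by positivity) (hbsin.intervalIntegrable _ _)
      ((hbcos.const_mul _).intervalIntegrable _ _) fun s hs => ?_
    rcases le_total σ s with h | h
    · simp [hb_right s h]
    · have hcs : 0 < cos s := cos_pos_of_mem_Ioo ⟨by linarith [hs.1], by linarith⟩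
      have hle : tan s ≤ tan σ := strictMonoOn_tan.monotoneOn
        ⟨by linarith [hs.1], by linarith⟩ ⟨by linarith, by linarith⟩ h
      rw [mul_left_comm]
      refine mul_le_mul_of_nonneg_left ?_ b.nonneg
      rw [← tan_mul_cos hcs.ne']
      exact mul_le_mul_of_nonneg_right hle hcs.le
  obtain ⟨l, φ, hl0, hlC, hφ, hcosφ, hsinφ⟩ := exists_scale_polar hc0 hc1 hτ0 hτ hC hS
    (hSC.trans_lt (mul_lt_mul_of_pos_right hσtan hC))
  have hg : ContDiff ℝ (⊤ : ℕ∞) fun s => l * b s := contDiff_const.mul hb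
  have hscale : ∀ k : ℝ → ℝ, ∫ s in (0 : ℝ)..(π / 2), l * b s * k s
      = l * ∫ s in (0 : ℝ)..(π / 2), b s * k s := fun k => by
    simp only [mul_assoc, intervalIntegral.integral_const_mul]
  refine ⟨forcedSine fun s => l * b s, φ, σ / 4, contDiff_forcedSine hg, hφ, by positivity,
    fun t ht => ?_, fun t ht => ?_, fun t ht => ?_, fun t ht => ?_⟩
  · exact forcedSine_eq_sin ht.1 fun s hs => by simp [hb_left s (hs.2.trans ht.2)]
  · rw [forcedSine_eq_of_eq_zero hg.continuous
      (fun s hs => by simp [hb_right s (hστ.le.trans hs.1)]) ht, hscale, hscale, hcosφ, hsinφ,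
      sin_add]
    ring
  · exact forcedSine_pos hg.continuous (fun s => mul_nonneg hl0 b.nonneg)
      (by rwa [hscale]) ht
  · rw [deriv_deriv_forcedSine hg.continuous]
    linarith [mul_nonneg hl0 (b.nonneg (x := t))]
end
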